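/- arXiv:2401.17219 — 3 statements merged into one kernel-verified Lean document; each statement's English description precedes it below -/
import Mathlib

section
/- Let ℓ ≥ 2, let α be a real number with α > (3ℓ−4)/(3ℓ−1), and let G be a graph on n ≥ 1 vertices with δ(G) ≥ αn whose vertex set is partitioned into ℓ independent sets U_1, …, U_ℓ. Then for all i ≠ j in {1,…,ℓ} and all vertices v ∈ U_i and v' ∈ U_j, the Hamming distance satisfies |N_G(v) △ N_G(v')| ≥ 2((2ℓ−1)α − 2ℓ + 3)·n > 2n/(3ℓ−1). -/
/-- An independent set misses the neighborhood of each of its vertices. -/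
lemma SimpleGraph.card_add_minDegree_le_of_forall_not_adj {V : Type*} [Fintype V] [DecidableEq V]
    (G : SimpleGraph V) [DecidableRel G.Adj] (s : Finset V)
    (hs : ∀ u ∈ s, ∀ v ∈ s, ¬ G.Adj u v) (hn : 1 ≤ Fintype.card V) :
    s.card + G.minDegree ≤ Fintype.card V := by
  rcases s.eq_empty_or_nonempty with rfl | ⟨u, hu⟩
  · obtain ⟨v⟩ := Fintype.card_pos_iff.mp hn
    have h₁ := G.minDegree_le_degree v
    have h₂ := G.degree_lt_card_verts v
    simp only [Finset.card_empty]
    omega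
  · have hd : Disjoint s (G.neighborFinset u) := by
      rw [Finset.disjoint_left]
      intro w hw hw'
      exact hs u hu w hw ((G.mem_neighborFinset u w).mp hw')
    have h₁ := Finset.card_le_univ (s ∪ G.neighborFinset u)
    rw [Finset.card_union_of_disjoint hd, G.card_neighborFinset_eq_degree] at h₁
    have h₂ := G.minDegree_le_degree u
    omega

/-- A vertex of an independent set `s` has many neighbors in any set `t` disjoint from `s`. -/
lemma SimpleGraph.minDegree_add_card_add_card_le {V : Type*} [Fintype V] [DecidableEq V]
    (G : SimpleGraph V) [DecidableRel G.Adj] {s t : Finset V} (hst : Disjoint s t)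
    {v : V} (hv : ∀ w ∈ s, ¬ G.Adj v w) :
    G.minDegree + s.card + t.card ≤ Fintype.card V + (G.neighborFinset v ∩ t).card := by
  have hd : Disjoint (G.neighborFinset v ∪ t) s := by
    rw [Finset.disjoint_union_left]
    refine ⟨?_, hst.symm⟩
    rw [Finset.disjoint_left]
    intro w hw hws
    exact hv w hws ((G.mem_neighborFinset v w).mp hw)
  have h₁ := Finset.card_le_univ ((G.neighborFinset v ∪ t) ∪ s)
  rw [Finset.card_union_of_disjoint hd] at h₁
  have h₂ := Finset.card_union_add_card_inter (G.neighborFinset v) t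
  rw [G.card_neighborFinset_eq_degree] at h₂
  have h₃ := G.minDegree_le_degree v
  omega

/-- Let `ℓ ≥ 2`, let `α > (3ℓ-4)/(3ℓ-1)`, and let `G` be a graph on `n ≥ 1`
vertices with `δ(G) ≥ α n` whose vertex set is partitioned into `ℓ` independent
sets. Then any two vertices in distinct parts have Hamming distance
`|N(v) △ N(v')| ≥ 2((2ℓ-1)α - 2ℓ + 3) n > 2n/(3ℓ-1)`. -/
theorem diff_part_hamming_far {V : Type*} [Fintype V] [DecidableEq V] (ℓ : ℕ)
    (hℓ : 2 ≤ ℓ) (α : ℝ) (hα : (3 * (ℓ : ℝ) - 4) / (3 * (ℓ : ℝ) - 1) < α)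
    (G : SimpleGraph V) [DecidableRel G.Adj]
    (hn : 1 ≤ Fintype.card V)
    (hdeg : α * (Fintype.card V : ℝ) ≤ (G.minDegree : ℝ))
    (U : Fin ℓ → Finset V)
    (hdisj : ∀ i j : Fin ℓ, i ≠ j → Disjoint (U i) (U j))
    (hcover : ∀ v : V, ∃ i : Fin ℓ, v ∈ U i)
    (hind : ∀ i : Fin ℓ, ∀ u ∈ U i, ∀ v ∈ U i, ¬ G.Adj u v) :
    ∀ i j : Fin ℓ, i ≠ j → ∀ v ∈ U i, ∀ v' ∈ U j,
      2 * ((2 * (ℓ : ℝ) - 1) * α - 2 * (ℓ : ℝ) + 3) * (Fintype.card V : ℝ)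
          ≤ ((symmDiff (G.neighborFinset v) (G.neighborFinset v')).card : ℝ) ∧
      2 * (Fintype.card V : ℝ) / (3 * (ℓ : ℝ) - 1)
          < 2 * ((2 * (ℓ : ℝ) - 1) * α - 2 * (ℓ : ℝ) + 3) * (Fintype.card V : ℝ) := by
  intro i j hij v hv v' hv'
  have hL : (2 : ℝ) ≤ ℓ := by exact_mod_cast hℓ
  have hn' : (1 : ℝ) ≤ Fintype.card V := by exact_mod_cast hn
  have hpos : (0 : ℝ) < 3 * ℓ - 1 := by linarith
  refine ⟨?_, ?_⟩
  · have hpart : ∀ k, ((U k).card : ℝ) ≤ Fintype.card V - α * Fintype.card V := by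
      intro k
      have h : ((U k).card : ℝ) + G.minDegree ≤ Fintype.card V := by
        exact_mod_cast G.card_add_minDegree_le_of_forall_not_adj (U k) (hind k) hn
      linarith
    have hsum : ∑ k, ((U k).card : ℝ) = Fintype.card V := by
      have h : Finset.univ.biUnion U = Finset.univ := by
        ext w
        simpa using hcover w
      rw [← Finset.card_univ, ← h,
        Finset.card_biUnion fun a _ b _ hab => hdisj a b hab]
      push_cast
      rfl
    have hall : (Fintype.card V : ℝ) ≤ ℓ * (Fintype.card V - α * Fintype.card V) := by
      have h := Finset.sum_le_card_nsmul Finset.univ _ _ fun k _ => hpart k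
      rw [hsum] at h
      simpa using h
    have hrest : (Fintype.card V : ℝ) ≤ (U i).card + (U j).card
        + (ℓ - 2) * (Fintype.card V - α * Fintype.card V) := by
      have h := Finset.sum_le_card_nsmul ({i, j}ᶜ : Finset (Fin ℓ)) _ _ fun k _ => hpart k
      rw [Finset.card_compl, Finset.card_pair hij, Fintype.card_fin, nsmul_eq_mul,
        Nat.cast_sub hℓ] at h
      have h' := Finset.sum_add_sum_compl ({i, j} : Finset (Fin ℓ)) fun k => ((U k).card : ℝ)
      rw [Finset.sum_pair hij, hsum] at h'
      push_cast at h
      linarith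
    have hv_nbr : (G.minDegree + (U i).card + (U j).card : ℝ)
        ≤ Fintype.card V + (G.neighborFinset v ∩ U j).card := by
      exact_mod_cast G.minDegree_add_card_add_card_le (hdisj i j hij) (hind i v hv)
    have hv'_nbr : (G.minDegree + (U j).card + (U i).card : ℝ)
        ≤ Fintype.card V + (G.neighborFinset v' ∩ U i).card := by
      exact_mod_cast G.minDegree_add_card_add_card_le (hdisj j i hij.symm) (hind j v' hv')
    have hsymm : ((G.neighborFinset v ∩ U j).card + (G.neighborFinset v' ∩ U i).card : ℝ)
        ≤ (symmDiff (G.neighborFinset v) (G.neighborFinset v')).card := by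
      have hd : Disjoint (G.neighborFinset v ∩ U j) (G.neighborFinset v' ∩ U i) :=
        (hdisj j i hij.symm).mono Finset.inter_subset_right Finset.inter_subset_right
      have hsub : (G.neighborFinset v ∩ U j) ∪ (G.neighborFinset v' ∩ U i)
          ⊆ symmDiff (G.neighborFinset v) (G.neighborFinset v') := by
        intro w hw
        have h₁ := hind i v hv w
        have h₂ := hind j v' hv' w
        simp only [Finset.mem_union, Finset.mem_inter, Finset.mem_symmDiff,
          SimpleGraph.mem_neighborFinset] at hw ⊢
        tauto
      have h := Finset.card_le_card hsub
      rw [Finset.card_union_of_disjoint hd] at h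
      exact_mod_cast h
    linarith
  · rw [div_lt_iff₀ hpos] at hα
    rw [div_lt_iff₀ hpos]
    have h : 1 < ((2 * (ℓ : ℝ) - 1) * α - 2 * ℓ + 3) * (3 * ℓ - 1) := by
      have := mul_lt_mul_of_pos_left hα (show (0 : ℝ) < 2 * ℓ - 1 by linarith)
      linarith
    have := mul_lt_mul_of_pos_right h (show (0 : ℝ) < Fintype.card V by linarith)
    linarith
end

section
/- For all integers ℓ ≥ 2 and n ≥ 1, the Turán numbers satisfy ex(n, K_{ℓ+1}) − ex(n−1, K_{ℓ+1}) = n − ⌈n/ℓ⌉. -/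
/-- The Turán number `ex(n, K_{ℓ+1})`: the maximum number of edges of an
`n`-vertex `K_{ℓ+1}`-free simple graph. -/
noncomputable def turanNumber (n ℓ : ℕ) : ℕ :=
  sSup {m : ℕ | ∃ G : SimpleGraph (Fin n), G.CliqueFree (ℓ + 1) ∧ G.edgeSet.ncard = m}

open Finset in
lemma turanNumber_eq_card_edgeFinset_turanGraph (n : ℕ) {ℓ : ℕ} (hℓ : 0 < ℓ) :
    turanNumber n ℓ = #(SimpleGraph.turanGraph n ℓ).edgeFinset := by
  classical
  refine IsGreatest.csSup_eq ⟨⟨_, SimpleGraph.turanGraph_cliqueFree hℓ, ?_⟩, ?_⟩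
  · rw [← SimpleGraph.coe_edgeFinset, Set.ncard_coe_finset]
  · rintro _ ⟨G, hG, rfl⟩
    rw [← SimpleGraph.coe_edgeFinset, Set.ncard_coe_finset]
    exact (SimpleGraph.isTuranMaximal_turanGraph hℓ).2 hG

open Finset in
lemma card_edgeFinset_turanGraph_of_le {n r : ℕ} (h : n ≤ r) :
    #(SimpleGraph.turanGraph n r).edgeFinset = n.choose 2 := by
  have htop := SimpleGraph.card_edgeFinset_top_eq_card_choose_two (V := Fin n)
  rw [Fintype.card_fin] at htop
  convert! htop
  exact SimpleGraph.turanGraph_eq_top.2 (.inr h)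

open Finset in
lemma card_edgeFinset_turanGraph_succ {r : ℕ} (hr : 0 < r) (n : ℕ) :
    #(SimpleGraph.turanGraph (n + 1) r).edgeFinset + n / r =
      #(SimpleGraph.turanGraph n r).edgeFinset + n := by
  induction n using Nat.strong_induction_on with
  | _ n ih =>
    rcases lt_or_ge n r with h | h
    · rw [card_edgeFinset_turanGraph_of_le h, card_edgeFinset_turanGraph_of_le h.le,
        Nat.div_eq_of_lt h, Nat.choose_succ_succ' n 1, Nat.choose_one_right]
      lia
    · obtain ⟨m, rfl⟩ := Nat.exists_eq_add_of_le' h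
      have hm := ih m (by lia)
      rw [Nat.add_right_comm, SimpleGraph.card_edgeFinset_turanGraph_add,
        SimpleGraph.card_edgeFinset_turanGraph_add, Nat.add_div_right _ hr, Nat.succ_mul]
      lia

/-- For all integers `ℓ ≥ 2` and `n ≥ 1`,
`ex(n, K_{ℓ+1}) - ex(n-1, K_{ℓ+1}) = n - ⌈n/ℓ⌉`. -/
theorem turanNumber_succ_diff (ℓ n : ℕ) (hℓ : 2 ≤ ℓ) (hn : 1 ≤ n) :
    (turanNumber n ℓ : ℤ) - (turanNumber (n - 1) ℓ : ℤ)
      = (n : ℤ) - ⌈(n : ℚ) / (ℓ : ℚ)⌉ := by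
  obtain ⟨m, rfl⟩ := Nat.exists_eq_add_of_le' hn
  have hpos : 0 < ℓ := by lia
  have hposQ : (0 : ℚ) < ℓ := by exact_mod_cast hpos
  have hceil : ⌈((m + 1 : ℕ) : ℚ) / (ℓ : ℚ)⌉ = ((m / ℓ : ℕ) : ℤ) + 1 := by
    rw [Int.ceil_eq_iff, lt_div_iff₀ hposQ, div_le_iff₀ hposQ]
    constructor
    · have h : m / ℓ * ℓ < m + 1 := Nat.lt_succ_of_le (Nat.div_mul_le_self m ℓ)
      rw [Int.cast_add, Int.cast_one, add_sub_cancel_right, Int.cast_natCast]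
      exact_mod_cast h
    · have h : m + 1 ≤ (m / ℓ + 1) * ℓ := Nat.lt_div_mul_add hpos |>.trans_eq (by ring)
      exact_mod_cast h
  have hsucc := card_edgeFinset_turanGraph_succ hpos m
  rw [hceil, Nat.add_sub_cancel, turanNumber_eq_card_edgeFinset_turanGraph _ hpos,
    turanNumber_eq_card_edgeFinset_turanGraph _ hpos]
  push_cast
  lia
end

section
/- Let P be a minimal r-pattern on ℓ vertices. Then there exist ε > 0 and n₀ such that for every n ≥ n₀ and every r-graph H on n vertices with δ(H) ≥ (r·λ_P − ε)·n^{r−1}, any two homomorphisms φ and ψ from H to P satisfy ψ = σ∘φ for some automorphism σ of P; that is, the homomorphism from H to P, if it exists, is unique up to an automorphism of P. -/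
open Finset

/-- An `r`-pattern: a positive integer `numV` (the vertex count) together with a
collection of `r`-element multisets on its vertex set. -/
structure Pattern (r : ℕ) where
  numV : ℕ
  pos : 0 < numV
  E : Finset (Multiset (Fin numV))
  card_eq : ∀ e ∈ E, Multiset.card e = r

/-- The Lagrange polynomial `Λ_P(x) = Σ_{e ∈ E} Π_i x_i^{e(i)} / e(i)!`. -/
noncomputable def Pattern.lagrangePoly {r : ℕ} (P : Pattern r)
    (x : Fin P.numV → ℝ) : ℝ :=
  ∑ e ∈ P.E, ∏ i : Fin P.numV, x i ^ (e.count i) / ((e.count i).factorial : ℝ)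

/-- The standard simplex `Δ^{ℓ-1}`. -/
def simplexOn (ℓ : ℕ) : Set (Fin ℓ → ℝ) :=
  {x | (∀ i, 0 ≤ x i) ∧ ∑ i, x i = 1}

/-- The Lagrangian `λ_P = max { Λ_P(x) : x ∈ Δ^{ℓ-1} }`. -/
noncomputable def Pattern.lagrangian {r : ℕ} (P : Pattern r) : ℝ :=
  sSup (P.lagrangePoly '' simplexOn P.numV)

/-- `P` is minimal if deleting any vertex `i` strictly decreases the
Lagrangian; since edges containing `i` evaluate to zero whenever `x i = 0`,
the Lagrangian of `P - i` equals the maximum of `Λ_P` over the face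
`{x ∈ Δ^{ℓ-1} : x i = 0}` of the simplex. -/
def Pattern.IsMinimal {r : ℕ} (P : Pattern r) : Prop :=
  ∀ i : Fin P.numV,
    sSup (P.lagrangePoly '' {x ∈ simplexOn P.numV | x i = 0}) < P.lagrangian

/-- A homomorphism from an `r`-graph `H` to the `r`-pattern `P` is a map on the
vertices sending (the vertex multiset of) every edge of `H` into `P.E`. -/
def IsPatternHom {r n : ℕ} (P : Pattern r) (H : Finset (Finset (Fin n)))
    (φ : Fin n → Fin P.numV) : Prop :=
  ∀ e ∈ H, Multiset.map φ e.val ∈ P.E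

/-- An automorphism of `P` is a permutation of its vertices preserving the
edge multisets. -/
def IsPatternAut {r : ℕ} (P : Pattern r) (σ : Equiv.Perm (Fin P.numV)) : Prop :=
  ∀ e ∈ P.E, Multiset.map σ e ∈ P.E

/-- The multiset of letters of a word. -/
def wordMultiset {α : Type*} {k : ℕ} (w : Fin k → α) : Multiset α :=
  (univ : Finset (Fin k)).val.map w

theorem map_wordMultiset {α β : Type*} {k : ℕ} (f : α → β) (w : Fin k → α) :
    (wordMultiset w).map f = wordMultiset fun t => f (w t) :=
  Multiset.map_map _ _ _

theorem wordMultiset_cons {α : Type*} {k : ℕ} (a : α) (w : Fin k → α) :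
    wordMultiset (Fin.cons a w : Fin (k + 1) → α) = a ::ₘ wordMultiset w := by
  simp [wordMultiset, Fin.univ_val_map, List.ofFn_succ]

theorem exists_wordMultiset_eq {α : Type*} {k : ℕ} (s : Multiset α)
    (hs : Multiset.card s = k) : ∃ w : Fin k → α, wordMultiset w = s := by
  induction s using Quotient.inductionOn with
  | h l =>
    subst hs
    refine ⟨l.get, ?_⟩
    refine (Fin.univ_val_map l.get).trans ?_
    rw [List.ofFn_get]
    rfl

theorem count_wordMultiset {α : Type*} [DecidableEq α] {k : ℕ} (w : Fin k → α) (a : α) :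
    (wordMultiset w).count a = #{t | w t = a} := by
  rw [wordMultiset, Multiset.count_map]
  simp only [eq_comm (a := a)]
  rfl

/-- The number of words with letter multiset `s`, times `∏ s(a)!`, is `|s|!`. -/
theorem card_wordMultiset_eq_mul_prod_factorial {α : Type*} [Fintype α] [DecidableEq α] {k : ℕ}
    (s : Multiset α) (hs : Multiset.card s = k) :
    #{w : Fin k → α | wordMultiset w = s} * ∏ a, (s.count a).factorial = k.factorial := by
  obtain ⟨w₀, rfl⟩ := exists_wordMultiset_eq s hs
  have hmem : ∀ g ∈ (univ : Finset (Equiv.Perm (Fin k))),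
      w₀ ∘ g ∈ ({w : Fin k → α | wordMultiset w = wordMultiset w₀} : Finset _) := by
    intro g _
    simp only [mem_filter, mem_univ, true_and]
    ext a
    rw [count_wordMultiset, count_wordMultiset]
    exact card_equiv g (by simp)
  have hfib : ∀ w ∈ ({w : Fin k → α | wordMultiset w = wordMultiset w₀} : Finset _),
      #{g : Equiv.Perm (Fin k) | w₀ ∘ g = w} = ∏ a, ((wordMultiset w₀).count a).factorial := by
    intro w hw
    simp only [mem_filter, mem_univ, true_and] at hw
    have hc : ∀ a, Nonempty ({t // w t = a} ≃ {t // w₀ t = a}) := fun a => by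
      refine ⟨Fintype.equivOfCardEq ?_⟩
      rw [Fintype.card_subtype, Fintype.card_subtype, ← count_wordMultiset,
        ← count_wordMultiset, hw]
    let h : Equiv.Perm (Fin k) := Equiv.ofFiberEquiv fun a => (hc a).some
    have hh : ∀ t, w₀ (h t) = w t := fun t => Equiv.ofFiberEquiv_map _ t
    have hst := DomMulAct.stabilizer_card w₀
    rw [Fintype.card_subtype] at hst
    simp only [Fintype.card_subtype, ← count_wordMultiset] at hst
    rw [← hst]
    refine card_equiv (Equiv.mulRight h⁻¹) fun g => ?_
    simp only [mem_filter, mem_univ, true_and, Equiv.coe_mulRight, funext_iff,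
      Function.comp_apply, Equiv.Perm.coe_mul]
    constructor
    · intro hg t
      rw [hg, ← hh]
      simp
    · intro hg t
      rw [← hh t, ← hg (h t)]
      simp
  have := card_eq_sum_card_fiberwise hmem
  rw [sum_congr rfl hfib, sum_const, smul_eq_mul, card_univ, Fintype.card_perm,
    Fintype.card_fin] at this
  exact this.symm

/-- Substituting the pushforward of a weight under `m` into a sum over words. -/
theorem sum_mul_prod_pushforward {α β : Type*} [Fintype α] [Fintype β] [DecidableEq α]
    [DecidableEq β] {k : ℕ} (m : α → β) (x : α → ℝ) (F : (Fin k → β) → ℝ) :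
    ∑ w : Fin k → β, F w * ∏ t, ∑ a with m a = w t, x a =
      ∑ w : Fin k → α, F (fun t => m (w t)) * ∏ t, x (w t) := by
  rw [← sum_fiberwise (univ : Finset (Fin k → α)) (fun w t => m (w t))]
  refine sum_congr rfl fun w _ => ?_
  rw [prod_univ_sum, mul_sum]
  have : Fintype.piFinset (fun t => ({a | m a = w t} : Finset α)) =
      ({u | (fun t => m (u t)) = w} : Finset (Fin k → α)) := by
    ext u
    simp [funext_iff]
  rw [this]
  refine sum_congr rfl fun u hu => ?_
  rw [(mem_filter.1 hu).2]

namespace Pattern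

variable {r : ℕ} (P : Pattern r)

/-- The Lagrange polynomial as a sum over words. -/
theorem factorial_mul_lagrangePoly (x : Fin P.numV → ℝ) :
    (r.factorial : ℝ) * P.lagrangePoly x =
      ∑ w : Fin r → Fin P.numV, (if wordMultiset w ∈ P.E then 1 else 0) * ∏ t, x (w t) := by
  simp only [ite_mul, one_mul, zero_mul]
  rw [← sum_filter, lagrangePoly, mul_sum,
    ← sum_fiberwise_of_maps_to (t := P.E) (g := wordMultiset) (by simp)]
  refine sum_congr rfl fun e he => ?_
  rw [filter_filter]
  have h1 : ∀ w ∈ ({w | wordMultiset w ∈ P.E ∧ wordMultiset w = e} : Finset (Fin r → _)),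
      ∏ t, x (w t) = ∏ i, x i ^ e.count i := by
    intro w hw
    rw [← (mem_filter.1 hw).2.2, ← prod_fiberwise univ w]
    refine prod_congr rfl fun i _ => ?_
    rw [count_wordMultiset, ← prod_const]
    exact prod_congr rfl fun t ht => by rw [(mem_filter.1 ht).2]
  rw [sum_congr rfl h1, sum_const, nsmul_eq_mul]
  have h2 : ({w | wordMultiset w ∈ P.E ∧ wordMultiset w = e} : Finset (Fin r → _)) =
      ({w | wordMultiset w = e} : Finset _) := by
    ext w
    simp only [mem_filter, mem_univ, true_and]
    exact ⟨And.right, fun h => ⟨h ▸ he, h⟩⟩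
  have h3 := card_wordMultiset_eq_mul_prod_factorial e (P.card_eq e he)
  rw [h2, ← h3, prod_div_distrib]
  push_cast
  have : ∏ i, ((e.count i).factorial : ℝ) ≠ 0 := prod_ne_zero_iff.2 fun i _ => by positivity
  field_simp

theorem continuous_lagrangePoly : Continuous P.lagrangePoly := by
  unfold lagrangePoly
  fun_prop

theorem isCompact_simplexOn (ℓ : ℕ) : IsCompact (simplexOn ℓ) :=
  isCompact_stdSimplex ℝ (Fin ℓ)

theorem bddAbove_lagrangePoly_image : BddAbove (P.lagrangePoly '' simplexOn P.numV) :=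
  (isCompact_simplexOn _).bddAbove_image P.continuous_lagrangePoly.continuousOn

theorem lagrangePoly_le_lagrangian {x : Fin P.numV → ℝ} (hx : x ∈ simplexOn P.numV) :
    P.lagrangePoly x ≤ P.lagrangian :=
  le_csSup P.bddAbove_lagrangePoly_image ⟨x, hx, rfl⟩

theorem simplexOn_nonempty : (simplexOn P.numV).Nonempty :=
  ⟨Pi.single ⟨0, P.pos⟩ 1, fun i => by
    by_cases h : i = ⟨0, P.pos⟩ <;> simp [h], by simp⟩

variable {P}

/-- In a minimal pattern, near-optimal weights are bounded away from zero. -/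
theorem IsMinimal.exists_pos_le_apply (hmin : P.IsMinimal) :
    ∃ ε : ℝ, 0 < ε ∧ ∃ c : ℝ, 0 < c ∧ ∀ x ∈ simplexOn P.numV,
      P.lagrangian - ε ≤ P.lagrangePoly x → ∀ i, c ≤ x i := by
  have key : ∀ i, ∃ δ : ℝ, 0 < δ ∧ ∀ x ∈ simplexOn P.numV,
      P.lagrangian - δ ≤ P.lagrangePoly x → δ ≤ x i := by
    intro i
    set M := sSup (P.lagrangePoly '' {x ∈ simplexOn P.numV | x i = 0}) with hM
    have hlt : M < P.lagrangian := hmin i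
    obtain ⟨a, ha, hle⟩ := IsCompact.exists_forall_le'
      (s := simplexOn P.numV ∩ {x | (M + P.lagrangian) / 2 ≤ P.lagrangePoly x}) (f := fun x => x i)
      (a := 0) ((isCompact_simplexOn _).inter_right
        (isClosed_le continuous_const P.continuous_lagrangePoly))
      (by fun_prop) (by
        rintro x ⟨hx, hx'⟩
        refine (hx.1 i).lt_of_ne fun h0 => ?_
        have : P.lagrangePoly x ≤ M :=
          le_csSup (P.bddAbove_lagrangePoly_image.mono (Set.image_mono fun _ h => h.1))
            ⟨x, ⟨hx, h0.symm⟩, rfl⟩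
        simp only [Set.mem_ofPred_eq] at hx'
        linarith)
    refine ⟨min a ((P.lagrangian - M) / 2), lt_min ha (by linarith), fun x hx h => ?_⟩
    refine (min_le_left _ _).trans (hle x ⟨hx, ?_⟩)
    have := min_le_right a ((P.lagrangian - M) / 2)
    simp only [Set.mem_ofPred_eq]
    linarith
  choose δ hδ h using key
  have : Nonempty (Fin P.numV) := ⟨⟨0, P.pos⟩⟩
  obtain ⟨i₀, hi₀⟩ := Finite.exists_min δ
  exact ⟨δ i₀, hδ i₀, δ i₀, hδ i₀, fun x hx hxl i =>
    (hi₀ i).trans (h i x hx (by linarith [hi₀ i]))⟩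

theorem map_update_mem_iff {j j' : Fin P.numV}
    (h : ∀ g : Multiset (Fin P.numV), j ::ₘ g ∈ P.E ↔ j' ::ₘ g ∈ P.E)
    (s : Multiset (Fin P.numV)) :
    s.map (Function.update id j j') ∈ P.E ↔ s ∈ P.E := by
  suffices ∀ t, s.map (Function.update id j j') + t ∈ P.E ↔ s + t ∈ P.E by
    simpa using this 0
  induction s using Multiset.induction with
  | empty => simp
  | cons a s ih =>
    intro t
    rw [Multiset.map_cons, Multiset.cons_add, Multiset.cons_add, ← Multiset.add_cons, ih,
      Multiset.add_cons]
    by_cases ha : a = j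
    · subst ha
      simp [h]
    · simp [ha]

/-- A minimal pattern has no two distinct twin vertices. -/
theorem IsMinimal.eq_of_twins (hmin : P.IsMinimal) {j j' : Fin P.numV}
    (h : ∀ g : Multiset (Fin P.numV), j ::ₘ g ∈ P.E ↔ j' ::ₘ g ∈ P.E) : j = j' := by
  by_contra hne
  refine (hmin j).not_ge (csSup_le (P.simplexOn_nonempty.image _) ?_)
  rintro _ ⟨x, hx, rfl⟩
  refine le_csSup (P.bddAbove_lagrangePoly_image.mono (Set.image_mono fun _ h => h.1))
    ⟨fun i => ∑ a with Function.update id j j' a = i, x a, ⟨⟨fun i => ?_, ?_⟩, ?_⟩, ?_⟩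
  · exact sum_nonneg fun a _ => hx.1 a
  · rw [sum_fiberwise]
    exact hx.2
  · refine sum_eq_zero fun a ha => ?_
    simp only [mem_filter, mem_univ, true_and, Function.update_apply, id] at ha
    split_ifs at ha with hj
    · exact absurd ha.symm hne
    · exact absurd ha hj
  · refine mul_left_cancel₀ (Nat.cast_ne_zero.2 r.factorial_ne_zero : (r.factorial : ℝ) ≠ 0) ?_
    rw [factorial_mul_lagrangePoly, factorial_mul_lagrangePoly,
      sum_mul_prod_pushforward (Function.update id j j') x
        (fun w => if wordMultiset w ∈ P.E then 1 else 0)]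
    simp only [← map_wordMultiset, map_update_mem_iff h]

/-- The normalised sizes of the fibres of a map. -/
noncomputable def fiberWeight {n ℓ : ℕ} (φ : Fin n → Fin ℓ) (i : Fin ℓ) : ℝ :=
  ∑ v with φ v = i, (1 / n : ℝ)

theorem fiberWeight_mem_simplexOn {n ℓ : ℕ} (hn : 0 < n) (φ : Fin n → Fin ℓ) :
    fiberWeight φ ∈ simplexOn ℓ := by
  refine ⟨fun i => sum_nonneg fun _ _ => by positivity, ?_⟩
  simp only [fiberWeight]
  rw [sum_fiberwise]
  have : (n : ℝ) ≠ 0 := by positivity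
  simp [this]

theorem natCast_mul_fiberWeight {n ℓ : ℕ} (hn : 0 < n) (φ : Fin n → Fin ℓ) (i : Fin ℓ) :
    (n : ℝ) * fiberWeight φ i = #{v | φ v = i} := by
  have : (n : ℝ) ≠ 0 := by positivity
  rw [fiberWeight, sum_const, nsmul_eq_mul]
  field_simp

/-- The words of length `k` over the domain of `φ` which, after adjoining the letter `i`,
are sent to an edge of `P`. -/
def linkWords {k n : ℕ} (P : Pattern (k + 1)) (φ : Fin n → Fin P.numV) (i : Fin P.numV) :
    Finset (Fin k → Fin n) :=
  {u | i ::ₘ wordMultiset (fun t => φ (u t)) ∈ P.E}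

theorem sum_card_linkWords {k n : ℕ} (P : Pattern (k + 1)) (hn : 0 < n)
    (φ : Fin n → Fin P.numV) :
    ∑ v, (#(linkWords P φ (φ v)) : ℝ) =
      (k + 1).factorial * P.lagrangePoly (fiberWeight φ) * n * n ^ k := by
  have hn' : (n : ℝ) ≠ 0 := by positivity
  rw [factorial_mul_lagrangePoly]
  simp only [fiberWeight]
  rw [sum_mul_prod_pushforward φ (fun _ => (1 / n : ℝ))
    (fun w => if wordMultiset w ∈ P.E then 1 else 0)]
  simp only [prod_const, card_univ, Fintype.card_fin]
  rw [← sum_mul, ← (Fin.consEquiv fun _ : Fin (k + 1) => Fin n).sum_comp, Fintype.sum_prod_type]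
  have h : ∀ v : Fin n, ∑ u : Fin k → Fin n,
      (if wordMultiset (fun t => φ ((Fin.consEquiv fun _ : Fin (k + 1) => Fin n) (v, u) t)) ∈ P.E
        then (1 : ℝ) else 0) = #(linkWords P φ (φ v)) := by
    intro v
    rw [linkWords, card_filter, Nat.cast_sum]
    refine sum_congr rfl fun u _ => ?_
    rw [← map_wordMultiset φ, ← map_wordMultiset φ, ← Multiset.map_cons, ← wordMultiset_cons]
    simp [Fin.consEquiv]
    congr
  rw [sum_congr rfl fun v _ => h v, one_div, inv_pow, pow_succ]
  field_simp

theorem factorial_mul_degree_le {k n : ℕ} {P : Pattern (k + 1)} {H : Finset (Finset (Fin n))}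
    (hH : ∀ e ∈ H, e.card = k + 1) {φ ψ : Fin n → Fin P.numV} (hφ : IsPatternHom P H φ)
    (hψ : IsPatternHom P H ψ) (v : Fin n) :
    k.factorial * #{e ∈ H | v ∈ e} ≤ #(linkWords P φ (φ v) ∩ linkWords P ψ (ψ v)) := by
  set D : Finset (Finset (Fin n)) := {e ∈ H | v ∈ e} with hD
  have hcard : ∀ e ∈ D, #{u : Fin k → Fin n | wordMultiset u = (e.erase v).val} = k.factorial := by
    intro e he
    obtain ⟨heH, hve⟩ := mem_filter.1 he
    have hk : Multiset.card (e.erase v).val = k := by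
      rw [card_val, card_erase_of_mem hve, hH e heH, Nat.add_sub_cancel]
    have := card_wordMultiset_eq_mul_prod_factorial (e.erase v).val hk
    rwa [prod_eq_one, mul_one] at this
    intro a _
    exact Nat.factorial_eq_one.2 (Multiset.nodup_iff_count_le_one.1 (e.erase v).nodup a)
  have hdisj : (D : Set (Finset (Fin n))).PairwiseDisjoint fun e =>
      ({u : Fin k → Fin n | wordMultiset u = (e.erase v).val} : Finset _) := by
    intro e he e' he' hne
    refine disjoint_left.2 fun u hu hu' => hne ?_
    simp only [mem_filter, mem_univ, true_and] at hu hu'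
    have : e.erase v = e'.erase v := val_injective (hu.symm.trans hu')
    rw [← insert_erase (mem_filter.1 he).2, this, insert_erase (mem_filter.1 he').2]
  rw [mul_comm, ← smul_eq_mul, ← sum_const, ← sum_congr rfl hcard, ← card_biUnion hdisj]
  refine card_le_card fun u hu => ?_
  simp only [mem_biUnion, mem_filter, mem_univ, true_and] at hu
  obtain ⟨e, he, hu⟩ := hu
  obtain ⟨heH, hve⟩ := mem_filter.1 he
  have hcons : v ::ₘ wordMultiset u = e.val := by
    rw [hu, erase_val, Multiset.cons_erase hve]
  simp only [linkWords, mem_inter, mem_filter, mem_univ, true_and]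
  rw [← map_wordMultiset φ, ← map_wordMultiset ψ, ← Multiset.map_cons, ← Multiset.map_cons, hcons]
  exact ⟨hφ e heH, hψ e heH⟩

/-- A vertex is heavy if at least `η n` vertices agree with it under both `φ` and `ψ`. -/
def IsHeavy {n ℓ : ℕ} (η : ℝ) (φ ψ : Fin n → Fin ℓ) (v : Fin n) : Prop :=
  η * n ≤ #{w | φ w = φ v ∧ ψ w = ψ v}

theorem IsHeavy.symm {n ℓ : ℕ} {η : ℝ} {φ ψ : Fin n → Fin ℓ} {v : Fin n}
    (h : IsHeavy η φ ψ v) : IsHeavy η ψ φ v := by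
  unfold IsHeavy at *
  simpa only [and_comm] using h

theorem exists_isHeavy {n ℓ : ℕ} {c : ℝ} (hn : 0 < n) (hc : 0 < c) (φ ψ : Fin n → Fin ℓ)
    (i : Fin ℓ) (hi : c ≤ fiberWeight φ i) : ∃ v, φ v = i ∧ IsHeavy (c / ℓ) φ ψ v := by
  have hℓ : (0 : ℝ) < ℓ := by exact_mod_cast i.pos
  have hn' : (0 : ℝ) < n := by exact_mod_cast hn
  have hcard : c * n ≤ #{v | φ v = i} := by
    rw [← natCast_mul_fiberWeight hn, mul_comm]
    gcongr
  have hsum : (#{v | φ v = i} : ℝ) = ∑ j, (#{v | φ v = i ∧ ψ v = j} : ℝ) := by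
    rw [card_eq_sum_card_fiberwise (t := univ) (f := ψ) (by simp)]
    push_cast
    simp only [filter_filter]
  obtain ⟨j, -, hj⟩ : ∃ j ∈ (univ : Finset (Fin ℓ)),
      c / ℓ * n ≤ (#{v | φ v = i ∧ ψ v = j} : ℝ) := by
    refine exists_le_of_sum_le ⟨i, mem_univ _⟩ ?_
    rw [← hsum, sum_const, card_univ, Fintype.card_fin, nsmul_eq_mul]
    rwa [← mul_assoc, mul_div_cancel₀ _ hℓ.ne']
  have hpos : (0 : ℝ) < #{v | φ v = i ∧ ψ v = j} := lt_of_lt_of_le (by positivity) hj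
  obtain ⟨v, hv⟩ := card_pos.1 (Nat.cast_pos.1 hpos)
  obtain ⟨rfl, rfl⟩ := (mem_filter.1 hv).2
  exact ⟨v, rfl, hj⟩

/-- If the link of `φ v` is not much larger than the common link, then adjoining `v` to a word of
heavy vertices cannot give an edge under `φ` but not under `ψ`. -/
theorem cons_mem_of_card_linkWords_lt {k n : ℕ} {P : Pattern (k + 1)} {φ ψ : Fin n → Fin P.numV}
    {η : ℝ} (hη : 0 ≤ η) {v : Fin n}
    (hlt : (#(linkWords P φ (φ v)) : ℝ) <
      #(linkWords P φ (φ v) ∩ linkWords P ψ (ψ v)) + (η * n) ^ k)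
    {u : Fin k → Fin n} (hu : ∀ t, IsHeavy η φ ψ (u t))
    (h : φ v ::ₘ wordMultiset (fun t => φ (u t)) ∈ P.E) :
    ψ v ::ₘ wordMultiset (fun t => ψ (u t)) ∈ P.E := by
  by_contra hnot
  refine hlt.not_ge ?_
  set B := Fintype.piFinset fun t => ({w | φ w = φ (u t) ∧ ψ w = ψ (u t)} : Finset (Fin n))
  have hB : ∀ w ∈ B, (fun t => φ (w t)) = (fun t => φ (u t)) ∧
      (fun t => ψ (w t)) = (fun t => ψ (u t)) := by
    intro w hw
    have := fun t => (mem_filter.1 (Fintype.mem_piFinset.1 hw t)).2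
    exact ⟨funext fun t => (this t).1, funext fun t => (this t).2⟩
  have hBcard : (η * n) ^ k ≤ (#B : ℝ) := by
    rw [Fintype.card_piFinset, Nat.cast_prod]
    calc (η * n) ^ k = ∏ _t : Fin k, (η * n) := by simp
      _ ≤ _ := prod_le_prod (fun _ _ => by positivity) fun t _ => hu t
  have hdisj : Disjoint (linkWords P φ (φ v) ∩ linkWords P ψ (ψ v)) B := by
    refine disjoint_left.2 fun w hw hwB => hnot ?_
    rw [← (hB w hwB).2]
    exact (mem_filter.1 (mem_inter.1 hw).2).2
  have hsub : (linkWords P φ (φ v) ∩ linkWords P ψ (ψ v)) ∪ B ⊆ linkWords P φ (φ v) := by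
    refine union_subset inter_subset_left fun w hw => ?_
    simp only [linkWords, mem_filter, mem_univ, true_and, (hB w hw).1, h]
  have := card_le_card hsub
  rw [card_union_of_disjoint hdisj] at this
  have : (#(linkWords P φ (φ v) ∩ linkWords P ψ (ψ v)) : ℝ) + #B ≤ #(linkWords P φ (φ v)) := by
    exact_mod_cast this
  linarith

/-- If all links have size at least `A` and the total is at most `n (A + δ)`, then the link of a
letter whose fibre has at least `c n` elements has size at most `A + δ / c`. -/
theorem mul_card_linkWords_sub_le {k n : ℕ} {P : Pattern (k + 1)} {φ : Fin n → Fin P.numV}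
    {A c δ : ℝ} (hn : 0 < n) (hA : ∀ v, A ≤ #(linkWords P φ (φ v)))
    (hsum : ∑ v, (#(linkWords P φ (φ v)) : ℝ) ≤ n * (A + δ)) (v : Fin n)
    (hc : c ≤ fiberWeight φ (φ v)) : c * (#(linkWords P φ (φ v)) - A) ≤ δ := by
  have hn' : (0 : ℝ) < n := by exact_mod_cast hn
  have h1 : ∑ w with φ w = φ v, ((#(linkWords P φ (φ w)) : ℝ) - A) ≤
      ∑ w, ((#(linkWords P φ (φ w)) : ℝ) - A) :=
    sum_le_sum_of_subset_of_nonneg (subset_univ _) fun w _ _ => sub_nonneg.2 (hA w)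
  have h2 : ∑ w with φ w = φ v, ((#(linkWords P φ (φ w)) : ℝ) - A) =
      (n * fiberWeight φ (φ v)) * (#(linkWords P φ (φ v)) - A) := by
    rw [natCast_mul_fiberWeight hn, ← nsmul_eq_mul, ← sum_const]
    exact sum_congr rfl fun w hw => by rw [(mem_filter.1 hw).2]
  rw [h2, sum_sub_distrib, sum_const, card_univ, Fintype.card_fin, nsmul_eq_mul] at h1
  have h3 : c * (#(linkWords P φ (φ v)) - A) ≤
      fiberWeight φ (φ v) * (#(linkWords P φ (φ v)) - A) :=
    mul_le_mul_of_nonneg_right hc (sub_nonneg.2 (hA v))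
  refine h3.trans (le_of_mul_le_mul_left ?_ hn')
  linarith

/-- If `v` and words of heavy vertices are consistent under `φ` and `ψ`, and every letter is the
`ψ`-image of a heavy vertex, then `φ` determines `ψ`. -/
theorem IsMinimal.eq_of_consistent {k n : ℕ} {P : Pattern (k + 1)} (hmin : P.IsMinimal)
    {φ ψ : Fin n → Fin P.numV} {b : Fin P.numV → Fin n} (hb : ∀ j, ψ (b j) = j)
    (hcons : ∀ v, ∀ w : Fin k → Fin P.numV,
      φ v ::ₘ wordMultiset (fun t => φ (b (w t))) ∈ P.E ↔
        ψ v ::ₘ wordMultiset (fun t => ψ (b (w t))) ∈ P.E)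
    {v v' : Fin n} (h : φ v = φ v') : ψ v = ψ v' := by
  refine hmin.eq_of_twins fun g => ?_
  by_cases hg : Multiset.card g = k
  · obtain ⟨w, rfl⟩ := exists_wordMultiset_eq g hg
    have h1 := hcons v w
    have h2 := hcons v' w
    simp only [hb] at h1 h2
    rw [← h1, ← h2, h]
  · have : ∀ i, i ::ₘ g ∉ P.E := fun i hi => hg (by simpa using P.card_eq _ hi)
    simp [this]

/-- The case of positive uniformity. -/
theorem IsMinimal.exists_aut {k n : ℕ} {P : Pattern (k + 1)} (hmin : P.IsMinimal)
    {φ ψ : Fin n → Fin P.numV} {a b : Fin P.numV → Fin n} (ha : ∀ i, φ (a i) = i)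
    (hb : ∀ j, ψ (b j) = j)
    (hφψ : ∀ v, ∀ w : Fin k → Fin P.numV,
      φ v ::ₘ wordMultiset (fun t => φ (a (w t))) ∈ P.E ↔
        ψ v ::ₘ wordMultiset (fun t => ψ (a (w t))) ∈ P.E)
    (hψφ : ∀ v, ∀ w : Fin k → Fin P.numV,
      φ v ::ₘ wordMultiset (fun t => φ (b (w t))) ∈ P.E ↔
        ψ v ::ₘ wordMultiset (fun t => ψ (b (w t))) ∈ P.E) :
    ∃ σ : Equiv.Perm (Fin P.numV), IsPatternAut P σ ∧ ψ = fun v => σ (φ v) := by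
  have hinj : Function.Injective fun i => ψ (a i) := fun i j hij => by
    rw [← ha i, ← ha j]
    exact hmin.eq_of_consistent ha (fun v w => (hφψ v w).symm) hij
  refine ⟨Equiv.ofBijective _ (Finite.injective_iff_bijective.1 hinj), fun e he => ?_, ?_⟩
  · obtain ⟨w, rfl⟩ := exists_wordMultiset_eq e (P.card_eq e he)
    rw [← Fin.cons_self_tail w, wordMultiset_cons] at he ⊢
    rw [Multiset.map_cons, map_wordMultiset]
    have := hφψ (a (w 0)) (Fin.tail w)
    simp only [ha] at this
    exact this.1 he
  · funext v
    exact hmin.eq_of_consistent hb hψφ (ha (φ v)).symm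

theorem IsMinimal.hom_unique_succ {k : ℕ} {P : Pattern (k + 1)} (hmin : P.IsMinimal) :
    ∃ ε : ℝ, 0 < ε ∧ ∀ n : ℕ, 0 < n →
      ∀ H : Finset (Finset (Fin n)), (∀ e ∈ H, e.card = k + 1) →
      (∀ v : Fin n, (((k : ℝ) + 1) * P.lagrangian - ε) * (n : ℝ) ^ k ≤ #{e ∈ H | v ∈ e}) →
      ∀ φ ψ : Fin n → Fin P.numV, IsPatternHom P H φ → IsPatternHom P H ψ →
        ∃ σ : Equiv.Perm (Fin P.numV), IsPatternAut P σ ∧ ψ = fun v => σ (φ v) := by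
  obtain ⟨ε₀, hε₀, c, hc, hweight⟩ := hmin.exists_pos_le_apply
  have hℓ : (0 : ℝ) < P.numV := by exact_mod_cast P.pos
  have hk : (0 : ℝ) < k.factorial := by positivity
  set η : ℝ := c / P.numV with hη
  have hη0 : 0 < η := by positivity
  obtain ⟨ε, hε, hlt⟩ := exists_between (a₁ := 0) (a₂ := min ε₀ (c * η ^ k / k.factorial))
    (by positivity)
  have hεε₀ := (hlt.trans_le (min_le_left _ _)).le
  have hεη : k.factorial * ε < c * η ^ k := by
    have := hlt.trans_le (min_le_right _ _)
    rw [lt_div_iff₀ hk] at this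
    linarith
  refine ⟨ε, hε, fun n hn H hH hdeg φ ψ hφ hψ => ?_⟩
  have hn' : (0 : ℝ) < n := by exact_mod_cast hn
  have hm : (0 : ℝ) < (n : ℝ) ^ k := by positivity
  set A : ℝ := k.factorial * ((((k : ℝ) + 1) * P.lagrangian - ε) * (n : ℝ) ^ k) with hA
  have hAle : ∀ v {φ ψ : Fin n → Fin P.numV}, IsPatternHom P H φ → IsPatternHom P H ψ →
      A ≤ #(linkWords P φ (φ v) ∩ linkWords P ψ (ψ v)) := by
    intro v φ ψ hφ hψ
    have h1 : (k.factorial : ℝ) * #{e ∈ H | v ∈ e} ≤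
        #(linkWords P φ (φ v) ∩ linkWords P ψ (ψ v)) := by
      exact_mod_cast factorial_mul_degree_le hH hφ hψ v
    exact (mul_le_mul_of_nonneg_left (hdeg v) hk.le).trans h1
  have hAlink : ∀ {φ : Fin n → Fin P.numV}, IsPatternHom P H φ → ∀ v,
      A ≤ #(linkWords P φ (φ v)) := fun hφ v => by
    simpa using hAle v hφ hφ
  have hsum : ∀ φ : Fin n → Fin P.numV, ∑ v, (#(linkWords P φ (φ v)) : ℝ) =
      n * (k.factorial * (((k : ℝ) + 1) * P.lagrangePoly (fiberWeight φ)) * n ^ k) := by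
    intro φ
    rw [sum_card_linkWords P hn, Nat.factorial_succ]
    push_cast
    ring
  have hc' : ∀ {φ : Fin n → Fin P.numV}, IsPatternHom P H φ → ∀ i, c ≤ fiberWeight φ i := by
    intro φ hφ
    refine hweight _ (fiberWeight_mem_simplexOn hn φ) ?_
    have h1 : (n : ℝ) * A ≤ ∑ v, (#(linkWords P φ (φ v)) : ℝ) := by
      have := card_nsmul_le_sum univ (fun v => (#(linkWords P φ (φ v)) : ℝ)) A
        fun v _ => hAlink hφ v
      simpa using this
    rw [hsum φ] at h1
    have h2 := le_of_mul_le_mul_left h1 hn'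
    rw [hA, mul_assoc] at h2
    have h3 := le_of_mul_le_mul_right (le_of_mul_le_mul_left h2 hk) hm
    have hk0 : (0 : ℝ) ≤ k := k.cast_nonneg
    have h4 : ((k : ℝ) + 1) * (P.lagrangian - ε) ≤
        ((k : ℝ) + 1) * P.lagrangePoly (fiberWeight φ) := by
      nlinarith [mul_nonneg hk0 hε.le]
    have h5 := le_of_mul_le_mul_left h4 (by positivity)
    linarith
  have himp : ∀ {φ ψ : Fin n → Fin P.numV}, IsPatternHom P H φ → IsPatternHom P H ψ →
      ∀ v, ∀ u : Fin k → Fin n, (∀ t, IsHeavy η φ ψ (u t)) →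
      φ v ::ₘ wordMultiset (fun t => φ (u t)) ∈ P.E →
      ψ v ::ₘ wordMultiset (fun t => ψ (u t)) ∈ P.E := by
    intro φ ψ hφ hψ v u hu h
    refine cons_mem_of_card_linkWords_lt hη0.le ?_ hu h
    have h1 := mul_card_linkWords_sub_le (δ := k.factorial * ε * n ^ k) hn (hAlink hφ)
      (by
        rw [hsum φ]
        refine mul_le_mul_of_nonneg_left ?_ hn'.le
        have h1 := P.lagrangePoly_le_lagrangian (fiberWeight_mem_simplexOn hn φ)
        have h2 : (k.factorial : ℝ) * (((k : ℝ) + 1) * P.lagrangePoly (fiberWeight φ)) * n ^ k ≤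
          k.factorial * (((k : ℝ) + 1) * P.lagrangian) * n ^ k := by gcongr
        refine h2.trans_eq ?_
        rw [hA]
        ring)
      v (hc' hφ _)
    have h2 := mul_lt_mul_of_pos_right hεη hm
    rw [mul_assoc c, ← mul_pow] at h2
    have h3 := lt_of_mul_lt_mul_left (h1.trans_lt h2) hc.le
    linarith [hAle v hφ hψ]
  choose a ha haH using fun i => exists_isHeavy hn hc φ ψ i (hc' hφ i)
  choose b hb hbH using fun j => exists_isHeavy hn hc ψ φ j (hc' hψ j)
  exact hmin.exists_aut ha hb
    (fun v w => ⟨himp hφ hψ v _ fun t => haH _, himp hψ hφ v _ fun t => (haH _).symm⟩)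
    (fun v w => ⟨himp hφ hψ v _ fun t => (hbH _).symm, himp hψ hφ v _ fun t => hbH _⟩)

end Pattern

/-- Let `P` be a minimal `r`-pattern. Then there are `ε > 0` and `n₀` such that
for every `r`-graph `H` on `n ≥ n₀` vertices with
`δ(H) ≥ (r λ_P - ε) n^{r-1}`, any two homomorphisms `φ, ψ` from `H` to `P`
differ by an automorphism of `P`: `ψ = σ ∘ φ`. -/
theorem hom_unique_of_isMinimal (r : ℕ) (P : Pattern r) (hmin : P.IsMinimal) :
    ∃ ε : ℝ, 0 < ε ∧ ∃ n₀ : ℕ, ∀ n : ℕ, n₀ ≤ n →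
      ∀ H : Finset (Finset (Fin n)), (∀ e ∈ H, e.card = r) →
      (∀ v : Fin n, ((r : ℝ) * P.lagrangian - ε) * (n : ℝ) ^ (r - 1)
        ≤ ((H.filter (fun e => v ∈ e)).card : ℝ)) →
      ∀ φ ψ : Fin n → Fin P.numV, IsPatternHom P H φ → IsPatternHom P H ψ →
        ∃ σ : Equiv.Perm (Fin P.numV), IsPatternAut P σ ∧ ψ = fun v => σ (φ v) := by
  cases r with
  | zero =>
    refine ⟨1, one_pos, 0, fun n _ H _ _ φ ψ _ _ => ⟨1, fun e he => by simpa using he, ?_⟩⟩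
    have hnot : ∀ (i : Fin P.numV) g, i ::ₘ g ∉ P.E := fun i g hi => by
      simpa using P.card_eq _ hi
    exact funext fun v => hmin.eq_of_twins fun g => by simp [hnot]
  | succ k =>
    obtain ⟨ε, hε, h⟩ := hmin.hom_unique_succ
    refine ⟨ε, hε, 1, fun n hn H hH hdeg => h n hn H hH fun v => ?_⟩
    simpa using hdeg v
end
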